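/- arXiv:1001.4863 — 4 statements merged into one kernel-verified Lean document; each statement's English description precedes it below -/
import Mathlib

section
/- Let λ > 0 and let (f,g) be a couple of functions in the class ℑ_λ such that f and g are differentiable on (0,λ). Then for every x ∈ (0,λ) one has (f'(x)/f(x))² ≤ −(2/(λ−x)) · (g'(x)/g(x)); equivalently, ((ln f)'(x))² ≤ −2 (ln g)'(x)/(λ−x). -/
/-- For `lam > 0`, a couple `(f, g)` of functions defined on `(0, lam)` belongs to the class
`ℑ_lam` provided that `f` and `g` are positive on `(0, lam)` and, for any distinct
`x, y ∈ (0, lam)`,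
`((f x - f y)/(x - y))² + ((f x)²/(g x (lam - x)) + (f y)²/(g y (lam - y))) · ((g x - g y)/(x - y)) ≤ 0`. -/
def MemIm (lam : ℝ) (f g : ℝ → ℝ) : Prop :=
  (∀ x ∈ Set.Ioo (0 : ℝ) lam, 0 < f x) ∧
  (∀ x ∈ Set.Ioo (0 : ℝ) lam, 0 < g x) ∧
  (∀ x ∈ Set.Ioo (0 : ℝ) lam, ∀ y ∈ Set.Ioo (0 : ℝ) lam, x ≠ y →
    ((f x - f y) / (x - y)) ^ 2 +
      ((f x) ^ 2 / (g x * (lam - x)) + (f y) ^ 2 / (g y * (lam - y))) *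
        ((g x - g y) / (x - y)) ≤ 0)

/-- If `(f, g) ∈ ℑ_lam` with `f` and `g` differentiable on `(0, lam)` (with derivatives
`f'` and `g'`), then for every `x ∈ (0, lam)` one has
`(f'(x)/f(x))² ≤ -(2/(lam - x)) · (g'(x)/g(x))`. -/
theorem memIm_necessary_condition (lam : ℝ) (hlam : 0 < lam) (f g f' g' : ℝ → ℝ)
    (hfg : MemIm lam f g)
    (hf : ∀ x ∈ Set.Ioo (0 : ℝ) lam, HasDerivAt f (f' x) x)
    (hg : ∀ x ∈ Set.Ioo (0 : ℝ) lam, HasDerivAt g (g' x) x) :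
    ∀ x ∈ Set.Ioo (0 : ℝ) lam,
      (f' x / f x) ^ 2 ≤ -(2 / (lam - x)) * (g' x / g x) := by
  obtain ⟨hf_pos, hg_pos, hineq⟩ := hfg
  intro x hx
  have hfx := hf_pos x hx
  have hgx := hg_pos x hx
  have hlx : 0 < lam - x := sub_pos.mpr hx.2
  have hden : g x * (lam - x) ≠ 0 := (mul_pos hgx hlx).ne'
  have hf_slope := hasDerivAt_iff_tendsto_slope.mp (hf x hx)
  have hg_slope := hasDerivAt_iff_tendsto_slope.mp (hg x hx)
  have hcoeff : ContinuousAt (fun y => (f y) ^ 2 / (g y * (lam - y))) x :=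
    ((hf x hx).continuousAt.pow 2).div
      ((hg x hx).continuousAt.mul (continuousAt_const.sub continuousAt_id)) hden
  have hlim := (hf_slope.pow 2).add
    (((hcoeff.tendsto.mono_left nhdsWithin_le_nhds).add_const
      ((f x) ^ 2 / (g x * (lam - x)))).mul hg_slope)
  have hle : (f' x) ^ 2 +
      ((f x) ^ 2 / (g x * (lam - x)) + (f x) ^ 2 / (g x * (lam - x))) * g' x ≤ 0 := by
    refine le_of_tendsto hlim ?_
    filter_upwards [self_mem_nhdsWithin,
      mem_nhdsWithin_of_mem_nhds (Ioo_mem_nhds hx.1 hx.2)] with y hyx hy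
    simpa only [slope_def_field] using hineq y hy x hx hyx
  have hdiv : ((f' x) ^ 2 +
      ((f x) ^ 2 / (g x * (lam - x)) + (f x) ^ 2 / (g x * (lam - x))) * g' x) / (f x) ^ 2 ≤ 0 :=
    div_nonpos_of_nonpos_of_nonneg hle (sq_nonneg _)
  have heq : ((f' x) ^ 2 +
      ((f x) ^ 2 / (g x * (lam - x)) + (f x) ^ 2 / (g x * (lam - x))) * g' x) / (f x) ^ 2 =
      (f' x / f x) ^ 2 + (2 / (lam - x)) * (g' x / g x) := by
    field_simp
    ring
  linarith
end

section
/- Let λ > 0 and let β ≥ 1/2. Then the couple of functions (f,g) defined on (0,λ) by f(x) = λ−x and g(x) = (λ−x)^β belongs to the class ℑ_λ. -/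
lemma mul_rpow_sq_le_of_le {a b β : ℝ} (hb : 0 < b) (hab : b ≤ a) (hβ : (1 : ℝ) / 2 ≤ β) :
    a * (b ^ β) ^ 2 ≤ b * (a ^ β) ^ 2 := by
  have ha : 0 < a := hb.trans_le hab
  have key : ∀ c : ℝ, 0 < c → (c ^ β) ^ 2 = c * c ^ (2 * β - 1) := fun c hc => by
    rw [pow_two, ← Real.rpow_add hc, ← Real.rpow_one_add' hc.le (by linarith)]
    ring_nf
  rw [key a ha, key b hb]
  have hmono : b ^ (2 * β - 1) ≤ a ^ (2 * β - 1) :=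
    Real.rpow_le_rpow hb.le hab (by linarith)
  nlinarith [mul_le_mul_of_nonneg_left hmono (mul_pos ha hb).le]

lemma sub_le_div_rpow_add_mul_sub {a b β : ℝ} (hb : 0 < b) (hab : b ≤ a)
    (hβ : (1 : ℝ) / 2 ≤ β) :
    a - b ≤ (a / a ^ β + b / b ^ β) * (a ^ β - b ^ β) := by
  have hp : 0 < a ^ β := Real.rpow_pos_of_pos (hb.trans_le hab) β
  have hq : 0 < b ^ β := Real.rpow_pos_of_pos hb β
  have h := mul_rpow_sq_le_of_le hb hab hβ
  have hdiff : (a / a ^ β + b / b ^ β) * (a ^ β - b ^ β) - (a - b) =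
      (b * (a ^ β) ^ 2 - a * (b ^ β) ^ 2) / (a ^ β * b ^ β) := by
    field_simp
    ring
  have := div_nonneg (sub_nonneg.2 h) (mul_pos hp hq).le
  linarith

lemma one_le_div_rpow_add_mul_slope {a b β : ℝ} (ha : 0 < a) (hb : 0 < b) (hab : a ≠ b)
    (hβ : (1 : ℝ) / 2 ≤ β) :
    1 ≤ (a / a ^ β + b / b ^ β) * ((a ^ β - b ^ β) / (a - b)) := by
  wlog h : b < a generalizing a b
  · have := this hb ha hab.symm (hab.lt_of_le (not_lt.1 h))
    rwa [add_comm, ← neg_sub (a ^ β), ← neg_sub a b, neg_div_neg_eq] at this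
  rw [← mul_div_assoc, one_le_div (sub_pos.2 h)]
  exact sub_le_div_rpow_add_mul_sub hb h.le hβ

/-- For `lam > 0` and `β ≥ 1/2`, the couple `(f, g)` with `f(x) = lam - x` and
`g(x) = (lam - x)^β` belongs to `ℑ_lam`. -/
theorem memIm_linear_rpow (lam : ℝ) (hlam : 0 < lam) (β : ℝ) (hβ : (1 : ℝ) / 2 ≤ β) :
    MemIm lam (fun x => lam - x) (fun x => (lam - x) ^ β) := by
  refine ⟨fun x hx => sub_pos.2 hx.2, fun x hx => Real.rpow_pos_of_pos (sub_pos.2 hx.2) β,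
    fun x hx y hy hxy => ?_⟩
  have ha : 0 < lam - x := sub_pos.2 hx.2
  have hb : 0 < lam - y := sub_pos.2 hy.2
  have hmain := one_le_div_rpow_add_mul_slope ha hb (fun h => hxy (by linarith)) hβ
  have hxy' : x - y = -((lam - x) - (lam - y)) := by ring
  have hne : (lam - x) - (lam - y) ≠ 0 := fun h => hxy (by linarith)
  have hcancel : ∀ c : ℝ, 0 < c → c ^ 2 / (c ^ β * c) = c / c ^ β := fun c hc => by
    rw [pow_two, mul_div_mul_right _ _ hc.ne']
  simp only [hxy', div_neg, div_self hne, hcancel _ ha, hcancel _ hb, mul_neg]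
  linarith
end

section
/- Let λ > 0 and let δ satisfy 0 < δ ≤ 2. Then the couple of functions (f,g) defined on (0,λ) by f(x) = g(x) = (λ−x)^δ belongs to the class ℑ_λ. In particular, (f,g) with f(x) = g(x) = (λ−x)² belongs to ℑ_λ. -/
/-- If `0 < b < a` and `A * b ^ 2 ≤ B * a ^ 2`, then the slope `(A - B) / (a - b)` is at most
`A / a + B / b`. -/
theorem slope_le_div_add_div {a b A B : ℝ} (hb : 0 < b) (hab : b < a)
    (h : A * b ^ 2 ≤ B * a ^ 2) : (A - B) / (a - b) ≤ A / a + B / b := by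
  have ha : 0 < a := hb.trans hab
  rw [div_add_div _ _ ha.ne' hb.ne', div_le_div_iff₀ (sub_pos.2 hab) (mul_pos ha hb)]
  linarith

/-- If `φ` is positive and increasing on `(0, ∞)` and `φ t / t ^ 2` is decreasing there (in
cross-multiplied form), then `(f, f)` with `f x = φ (lam - x)` belongs to `ℑ_lam`. -/
theorem memIm_comp_sub (lam : ℝ) {φ : ℝ → ℝ} (hpos : ∀ t, 0 < t → 0 < φ t)
    (hmono : ∀ b a, 0 < b → b < a → φ b ≤ φ a)
    (hanti : ∀ b a, 0 < b → b < a → φ a * b ^ 2 ≤ φ b * a ^ 2) :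
    MemIm lam (fun x => φ (lam - x)) (fun x => φ (lam - x)) := by
  have hpos' : ∀ x ∈ Set.Ioo (0 : ℝ) lam, 0 < φ (lam - x) :=
    fun x hx => hpos _ (sub_pos.2 hx.2)
  refine ⟨hpos', hpos', fun x hx y hy hxy => ?_⟩
  dsimp only
  wlog hlt : x < y generalizing x y
  · have := this y hy x hx hxy.symm (lt_of_le_of_ne (not_lt.1 hlt) hxy.symm)
    rwa [← neg_sub (φ (lam - x)), ← neg_sub x y, neg_div_neg_eq, add_comm (_ / _) (_ / _)] at this
  have hy0 : 0 < lam - y := sub_pos.2 hy.2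
  have hyx : lam - y < lam - x := by linarith
  have hslope := slope_le_div_add_div hy0 hyx (hanti _ _ hy0 hyx)
  have hneg : (φ (lam - x) - φ (lam - y)) / (x - y) ≤ 0 :=
    div_nonpos_of_nonneg_of_nonpos (sub_nonneg.2 (hmono _ _ hy0 hyx)) (by linarith)
  rw [show lam - x - (lam - y) = -(x - y) by ring, div_neg] at hslope
  rw [sq (φ (lam - x)), sq (φ (lam - y)), mul_div_mul_left _ _ (hpos' x hx).ne',
    mul_div_mul_left _ _ (hpos' y hy).ne', sq, ← add_mul]
  exact mul_nonpos_of_nonneg_of_nonpos (by linarith) hneg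

/-- For `lam > 0` and `0 < δ ≤ 2`, the couple `(f, g)` with `f(x) = g(x) = (lam - x)^δ`
belongs to `ℑ_lam`; in particular `(f, g)` with `f(x) = g(x) = (lam - x)²` belongs to `ℑ_lam`. -/
theorem memIm_rpow_rpow (lam : ℝ) (hlam : 0 < lam) (δ : ℝ) (hδ0 : 0 < δ) (hδ2 : δ ≤ 2) :
    MemIm lam (fun x => (lam - x) ^ δ) (fun x => (lam - x) ^ δ) ∧
      MemIm lam (fun x => (lam - x) ^ (2 : ℕ)) (fun x => (lam - x) ^ (2 : ℕ)) := by
  have hpow : ∀ δ : ℝ, 0 < δ → δ ≤ 2 →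
      MemIm lam (fun x => (lam - x) ^ δ) (fun x => (lam - x) ^ δ) := by
    intro δ hδ0 hδ2
    refine memIm_comp_sub lam (φ := fun t => t ^ δ) (fun t ht => Real.rpow_pos_of_pos ht δ)
      (fun b a hb hab => Real.rpow_le_rpow hb.le hab.le hδ0.le) (fun b a hb hab => ?_)
    have ha : 0 < a := hb.trans hab
    have h := Real.rpow_le_rpow_of_nonpos hb hab.le (sub_nonpos.2 hδ2)
    rwa [Real.rpow_sub ha, Real.rpow_sub hb, Real.rpow_two, Real.rpow_two,
      div_le_div_iff₀ (pow_pos ha 2) (pow_pos hb 2)] at h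
  exact ⟨hpow δ hδ0 hδ2, by simpa only [Real.rpow_two] using hpow 2 two_pos le_rfl⟩
end

section
/- Let n ≥ 2 and let u be a smooth compactly supported function on the half-space {x ∈ ℝⁿ : x_n > 0} with ∫ u² dμ = 1, where dμ = x_n^{−n} dx is the hyperbolic volume measure. Then ∫ ( (1−n) u + 2 x_n ∂u/∂x_n )² dμ ≤ 4 ( ∫ (Δ_ℍ u)² dμ )^{1/2} − (n−1)², where Δ_ℍ u = x_n² ∑_{j=1}^{n} ∂²u/∂x_j² + (2−n) x_n ∂u/∂x_n. -/
open MeasureTheory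

/-- The partial derivative `∂u/∂x_j` of a function `u : ℝⁿ → ℝ`. -/
noncomputable def pderiv' {n : ℕ} (j : Fin n) (u : (Fin n → ℝ) → ℝ) (x : Fin n → ℝ) : ℝ :=
  fderiv ℝ u x (Pi.single j 1)

/-- The Laplacian of the hyperbolic space `ℍⁿ` in the half-space model, where `ln` is the
index of the last coordinate `x_n`:
`Δ_ℍ u = x_n² ∑_j ∂²u/∂x_j² + (2-n) x_n ∂u/∂x_n`. -/
noncomputable def hypLap {n : ℕ} (ln : Fin n) (u : (Fin n → ℝ) → ℝ) (x : Fin n → ℝ) : ℝ :=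
  (x ln) ^ 2 * ∑ j : Fin n, pderiv' j (pderiv' j u) x +
    (2 - (n : ℝ)) * x ln * pderiv' ln u x

/-- A continuous function vanishing outside a compact subset of the half-space `{x | 0 < x ln}`
is integrable against every power of the last coordinate. -/
theorem integrable_mul_rpow_of_isCompact {n : ℕ} {ln : Fin n} {K : Set (Fin n → ℝ)}
    (hK : IsCompact K) (hKpos : ∀ x ∈ K, 0 < x ln) {g : (Fin n → ℝ) → ℝ} (hg : Continuous g)
    (hg0 : ∀ x, x ∉ K → g x = 0) (s : ℝ) :
    Integrable (fun x : Fin n → ℝ => g x * x ln ^ s) := by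
  rw [← integrableOn_iff_integrable_of_support_subset (s := K)]
  · refine ContinuousOn.integrableOn_compact hK (hg.continuousOn.mul ?_)
    exact (continuous_apply ln).continuousOn.rpow_const fun x hx => Or.inl (hKpos x hx).ne'
  · intro x hx
    by_contra h
    simp [hg0 x h] at hx

theorem pderiv'_eq_zero_of_notMem_isClosed {n : ℕ} {K : Set (Fin n → ℝ)} (hK : IsClosed K)
    {g : (Fin n → ℝ) → ℝ} (hg0 : ∀ x, x ∉ K → g x = 0) (j : Fin n) {x : Fin n → ℝ}
    (hx : x ∉ K) : pderiv' j g x = 0 := by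
  have h : g =ᶠ[nhds x] fun _ => 0 := by
    filter_upwards [hK.isOpen_compl.mem_nhds hx] with y hy using hg0 y hy
  simp [pderiv', h.fderiv_eq]

theorem continuous_pderiv' {n : ℕ} {g : (Fin n → ℝ) → ℝ} (hg : ContDiff ℝ 1 g) (j : Fin n) :
    Continuous (pderiv' j g) :=
  (hg.continuous_fderiv one_ne_zero).clm_apply continuous_const

theorem contDiff_pderiv' {n : ℕ} {g : (Fin n → ℝ) → ℝ} (hg : ContDiff ℝ (⊤ : ℕ∞) g) (j : Fin n) :
    ContDiff ℝ (⊤ : ℕ∞) (pderiv' j g) :=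
  (hg.fderiv_right (m := (⊤ : ℕ∞)) (by simp)).clm_apply contDiff_const

theorem pderiv'_mul {n : ℕ} {f g : (Fin n → ℝ) → ℝ} {x : Fin n → ℝ}
    (hf : DifferentiableAt ℝ f x) (hg : DifferentiableAt ℝ g x) (j : Fin n) :
    pderiv' j (fun y => f y * g y) x = f x * pderiv' j g x + pderiv' j f x * g x := by
  simp only [pderiv', fderiv_fun_mul hf hg, add_apply,
    smul_apply, smul_eq_mul]
  ring

theorem pderiv'_rpow {n : ℕ} {ln : Fin n} {x : Fin n → ℝ} (hx : 0 < x ln) (s : ℝ) (j : Fin n) :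
    pderiv' j (fun y => y ln ^ s) x = if j = ln then s * x ln ^ (s - 1) else 0 := by
  have h1 : HasFDerivAt (fun y : Fin n → ℝ => y ln)
      (ContinuousLinearMap.proj (R := ℝ) (φ := fun _ : Fin n => ℝ) ln) x :=
    (ContinuousLinearMap.proj (R := ℝ) (φ := fun _ : Fin n => ℝ) ln).hasFDerivAt
  have h2 := h1.rpow_const (p := s) (Or.inl hx.ne')
  rw [pderiv', h2.fderiv]
  by_cases h : j = ln
  · subst h; simp
  · simp [h, Ne.symm h]

/-- The divergence theorem for `x_n^s g`, with `g` supported in a compact subset of the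
half-space. -/
theorem integrableOn_and_integral_pderiv'_rpow_mul_eq_zero {n : ℕ} {ln : Fin n}
    {K : Set (Fin n → ℝ)} (hK : IsCompact K) (hKpos : ∀ x ∈ K, 0 < x ln)
    {g : (Fin n → ℝ) → ℝ} (hg : ContDiff ℝ 1 g) (hg0 : ∀ x, x ∉ K → g x = 0)
    (s : ℝ) (j : Fin n) :
    IntegrableOn (fun x => pderiv' j g x * x ln ^ s +
        (if j = ln then s * (g x * x ln ^ (s - 1)) else 0)) {x | 0 < x ln} ∧
      ∫ x in {x | 0 < x ln}, (pderiv' j g x * x ln ^ s +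
        (if j = ln then s * (g x * x ln ^ (s - 1)) else 0)) = 0 := by
  have hts : tsupport g ⊆ K := closure_minimal
    (fun x hx => by by_contra h; exact hx (hg0 x h)) hK.isClosed
  have hd0 : ∀ x, x ∉ K → pderiv' j g x = 0 := fun x =>
    pderiv'_eq_zero_of_notMem_isClosed hK.isClosed hg0 j
  have hI1 := integrable_mul_rpow_of_isCompact hK hKpos (continuous_pderiv' hg j) hd0 s
  have hI2 : Integrable (fun x => if j = ln then s * (g x * x ln ^ (s - 1)) else 0) := by
    split_ifs
    · exact (integrable_mul_rpow_of_isCompact hK hKpos hg.continuous hg0 (s - 1)).const_mul s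
    · exact integrable_zero _ _ _
  have hEq : (fun x => fderiv ℝ (fun y : Fin n → ℝ => y ln ^ s) x (Pi.single j 1) * g x) =
      fun x => if j = ln then s * (g x * x ln ^ (s - 1)) else 0 := by
    funext x
    by_cases hx : x ∈ K
    · have := pderiv'_rpow (hKpos x hx) s j
      rw [pderiv'] at this
      rw [this]
      split_ifs <;> ring
    · simp [hg0 x hx]
  have key := integral_mul_fderiv_eq_neg_fderiv_mul_of_integrable (μ := volume)
    (f := fun y : Fin n → ℝ => y ln ^ s) (g := g) (v := Pi.single j 1)
    (by rw [hEq]; exact hI2) (by simpa only [pderiv', mul_comm] using hI1)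
    (by simpa only [mul_comm] using
      integrable_mul_rpow_of_isCompact hK hKpos hg.continuous hg0 s)
    (fun x hx => (differentiableAt_apply ln x).rpow_const (Or.inl (hKpos x (hts hx)).ne'))
    (fun x _ => hg.differentiable one_ne_zero x)
  rw [hEq] at key
  refine ⟨(hI1.add hI2).integrableOn, ?_⟩
  rw [setIntegral_eq_integral_of_forall_compl_eq_zero, integral_add hI1 hI2]
  · simp only [pderiv'] at key ⊢
    simp only [mul_comm] at key ⊢
    rw [key]; simp
  · intro x hx
    have hxK : x ∉ K := fun h => hx (hKpos x h)
    simp [hd0 x hxK, hg0 x hxK]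

/-- Cauchy–Schwarz against a function of unit norm, in the form `-∫ f g w ≤ √(∫ g² w)`. -/
theorem neg_integral_mul_le_sqrt_of_integral_sq_eq_one {α : Type*} [MeasurableSpace α]
    {μ : Measure α} {f g w : α → ℝ} (hw : ∀ᵐ x ∂μ, 0 ≤ w x)
    (hff : Integrable (fun x => f x ^ 2 * w x) μ) (hfg : Integrable (fun x => f x * g x * w x) μ)
    (hgg : Integrable (fun x => g x ^ 2 * w x) μ) (hf : ∫ x, f x ^ 2 * w x ∂μ = 1) :
    -∫ x, f x * g x * w x ∂μ ≤ √(∫ x, g x ^ 2 * w x ∂μ) := by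
  set B := ∫ x, f x * g x * w x ∂μ
  have h0 : 0 ≤ ∫ x, (B ^ 2 * (f x ^ 2 * w x) - 2 * B * (f x * g x * w x) + g x ^ 2 * w x) ∂μ := by
    refine integral_nonneg_of_ae ?_
    filter_upwards [hw] with x hx
    have : 0 ≤ (B * f x - g x) ^ 2 * w x := by positivity
    simp only [Pi.zero_apply]
    linarith
  have hsum : ∫ x, (B ^ 2 * (f x ^ 2 * w x) - 2 * B * (f x * g x * w x) + g x ^ 2 * w x) ∂μ =
      B ^ 2 * 1 - 2 * B * B + ∫ x, g x ^ 2 * w x ∂μ := by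
    have hsub : Integrable (fun x => B ^ 2 * (f x ^ 2 * w x) - 2 * B * (f x * g x * w x)) μ :=
      (hff.const_mul _).sub (hfg.const_mul _)
    rw [integral_add hsub hgg,
      integral_sub (hff.const_mul _) (hfg.const_mul _), integral_const_mul, integral_const_mul, hf]
  apply Real.le_sqrt_of_sq_le
  nlinarith

/-- For `u` smooth and compactly supported in the half-space `{x ∈ ℝⁿ : x_n > 0}` (`n ≥ 2`)
with `∫ u² dμ = 1` (`dμ = x_n^{-n} dx` the hyperbolic volume), one has
`∫ ((1-n)u + 2 x_n ∂u/∂x_n)² dμ ≤ 4 √(∫ (Δ_ℍ u)² dμ) - (n-1)²`. -/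
theorem norm_commutator_le (n : ℕ) (hn : 2 ≤ n) (u : (Fin n → ℝ) → ℝ)
    (hu : ContDiff ℝ (⊤ : ℕ∞) u) (hcs : HasCompactSupport u)
    (hsupp : tsupport u ⊆ {y : Fin n → ℝ | 0 < y ⟨n - 1, by omega⟩})
    (hnorm : (∫ x in {y : Fin n → ℝ | 0 < y ⟨n - 1, by omega⟩},
        (u x) ^ 2 * (x ⟨n - 1, by omega⟩) ^ (-(n : ℝ))) = 1) :
    (∫ x in {y : Fin n → ℝ | 0 < y ⟨n - 1, by omega⟩},
        ((1 - (n : ℝ)) * u x +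
            2 * x ⟨n - 1, by omega⟩ * pderiv' ⟨n - 1, by omega⟩ u x) ^ 2 *
          (x ⟨n - 1, by omega⟩) ^ (-(n : ℝ))) ≤
      4 * Real.sqrt (∫ x in {y : Fin n → ℝ | 0 < y ⟨n - 1, by omega⟩},
          (hypLap ⟨n - 1, by omega⟩ u x) ^ 2 * (x ⟨n - 1, by omega⟩) ^ (-(n : ℝ))) -
        ((n : ℝ) - 1) ^ 2 := by
  generalize (⟨n - 1, by omega⟩ : Fin n) = ln at hsupp hnorm ⊢
  have hKpos : ∀ x ∈ tsupport u, 0 < x ln := fun x hx => hsupp hx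
  have hK : IsCompact (tsupport u) := hcs
  have hu0 : ∀ x, x ∉ tsupport u → u x = 0 := fun x => image_eq_zero_of_notMem_tsupport
  have hd0 : ∀ j x, x ∉ tsupport u → pderiv' j u x = 0 := fun j x =>
    pderiv'_eq_zero_of_notMem_isClosed hK.isClosed hu0 j
  have hdd0 : ∀ j x, x ∉ tsupport u → pderiv' j (pderiv' j u) x = 0 := fun j x =>
    pderiv'_eq_zero_of_notMem_isClosed hK.isClosed (hd0 j) j
  have hu1 : ContDiff ℝ 1 u := hu.of_le (by simp)
  have hd1 : ∀ j, ContDiff ℝ 1 (pderiv' j u) := fun j => (contDiff_pderiv' hu j).of_le (by simp)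
  have huc := hu1.continuous
  have hdc : ∀ j, Continuous (pderiv' j u) := fun j => (hd1 j).continuous
  have hddc : ∀ j, Continuous (pderiv' j (pderiv' j u)) := fun j => continuous_pderiv' (hd1 j) j
  have hLc : Continuous (hypLap ln u) := by unfold hypLap; fun_prop
  have hL0 : ∀ x, x ∉ tsupport u → hypLap ln u x = 0 := fun x hx => by
    simp [hypLap, hd0 _ x hx, hdd0 _ x hx]
  set H : Set (Fin n → ℝ) := {y | 0 < y ln}
  have hHm : MeasurableSet H := measurableSet_lt measurable_const (measurable_pi_apply ln)
  have hI : ∀ g : (Fin n → ℝ) → ℝ, Continuous g → (∀ x, x ∉ tsupport u → g x = 0) →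
      IntegrableOn (fun x => g x * x ln ^ (-(n : ℝ))) H := fun g hg hg0 =>
    (integrable_mul_rpow_of_isCompact hK hKpos hg hg0 _).integrableOn
  have huu := hI (fun x => u x ^ 2) (by fun_prop) (fun x hx => by simp [hu0 x hx])
  have huL := hI (fun x => u x * hypLap ln u x) (by fun_prop) (fun x hx => by simp [hu0 x hx])
  have hLL := hI (fun x => hypLap ln u x ^ 2) (by fun_prop) (fun x hx => by simp [hL0 x hx])
  have hlhs := hI (fun x => ((1 - (n : ℝ)) * u x + 2 * x ln * pderiv' ln u x) ^ 2)
    (by fun_prop) (fun x hx => by simp [hu0 x hx, hd0 ln x hx])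
  have hCS := neg_integral_mul_le_sqrt_of_integral_sq_eq_one (μ := volume.restrict H)
    (f := u) (g := hypLap ln u) (w := fun x => x ln ^ (-(n : ℝ)))
    (ae_restrict_of_forall_mem hHm fun x hx => Real.rpow_nonneg (le_of_lt hx) _)
    huu huL hLL hnorm
  obtain ⟨hA, hA0⟩ := integrableOn_and_integral_pderiv'_rpow_mul_eq_zero hK hKpos
    (hu1.mul hu1) (fun x hx => by simp [hu0 x hx]) (1 - n) ln
  have hB := fun j => integrableOn_and_integral_pderiv'_rpow_mul_eq_zero hK hKpos
    (hu1.mul (hd1 j)) (fun x hx => by simp [hu0 x hx]) (2 - n) j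
  have hBs := integrable_finsetSum Finset.univ fun j _ => (hB j).1
  have hBs0 := integral_finsetSum (μ := volume.restrict H) Finset.univ fun j _ => (hB j).1
  rw [Finset.sum_eq_zero fun j _ => (hB j).2] at hBs0
  have hle := setIntegral_mono_on hlhs
    ((((huu.const_mul (-((n : ℝ) - 1) ^ 2)).sub (hA.const_mul (2 * ((n : ℝ) - 1)))).add
      (hBs.const_mul 4)).sub (huL.const_mul 4)) hHm ?_
  · refine hle.trans ?_
    rw [integral_sub' (((huu.const_mul _).sub (hA.const_mul _)).add (hBs.const_mul _))
        (huL.const_mul _), integral_add' ((huu.const_mul _).sub (hA.const_mul _)) (hBs.const_mul _),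
      integral_sub' (huu.const_mul _) (hA.const_mul _), integral_const_mul, integral_const_mul,
      integral_const_mul, integral_const_mul, hA0, hBs0, hnorm]
    linarith
  · intro x hx
    have hx : 0 < x ln := hx
    have hud := hu1.differentiable one_ne_zero x
    have hdd := fun j => (hd1 j).differentiable one_ne_zero x
    have e1 : x ln ^ (1 - (n : ℝ)) = x ln * x ln ^ (-(n : ℝ)) := by
      rw [sub_eq_add_neg, Real.rpow_add hx, Real.rpow_one]
    have e1' : x ln ^ ((2 : ℝ) - n - 1) = x ln * x ln ^ (-(n : ℝ)) := by
      rw [← e1]; ring_nf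
    have e2 : x ln ^ ((2 : ℝ) - n) = x ln ^ 2 * x ln ^ (-(n : ℝ)) := by
      rw [sub_eq_add_neg, Real.rpow_add hx, Real.rpow_two]
    have e0 : x ln ^ ((1 : ℝ) - n - 1) = x ln ^ (-(n : ℝ)) := by ring_nf
    have hw : 0 ≤ x ln ^ (-(n : ℝ)) := Real.rpow_nonneg hx.le _
    simp only [Pi.add_apply, Pi.sub_apply, pderiv'_mul hud hud, pderiv'_mul hud (hdd _), e1, e1',
      e2, e0, if_true, Finset.sum_add_distrib, Finset.sum_ite_eq', Finset.mem_univ,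
      ← Finset.sum_mul, ← Finset.mul_sum, hypLap]
    have hsq : pderiv' ln u x * pderiv' ln u x ≤ ∑ j, pderiv' j u x * pderiv' j u x :=
      Finset.single_le_sum (f := fun j => pderiv' j u x * pderiv' j u x)
        (fun j _ => mul_self_nonneg _) (Finset.mem_univ ln)
    have := mul_le_mul_of_nonneg_right hsq (mul_nonneg (sq_nonneg (x ln)) hw)
    linarith
end
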